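/- arXiv:2212.08260 — 2 statements merged into one kernel-verified Lean document; each statement's English description precedes it below -/
import Mathlib

section
/- Let E be a real Hilbert space, let C be a nonempty closed convex subset of E with metric projection P : E → E (so P x ∈ C and ‖x − P x‖ ≤ ‖x − y‖ for all y ∈ C), let μ > 0, let H : E → E be a continuous linear map, let h ∈ E, and let f̄ : E → ℝ be differentiable with α-Lipschitz gradient. Define L : E → ℝ by L(z) = f̄(H z + h) + (1/(2μ)) ‖P(H z + h) − (H z + h)‖². Then L is differentiable everywhere and its gradient ∇L is Lipschitz with constant ‖H‖² (α + 2/μ); in particular L is smooth. -/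
open scoped InnerProductSpace

section MetricProjection

variable {E : Type*} [NormedAddCommGroup E] [InnerProductSpace ℝ E] {C : Set E} {P : E → E}

/-- The variational inequality characterizing a nearest point of a convex set. -/
lemma inner_sub_proj_nonpos (hC : Convex ℝ C) (hPmem : ∀ x, P x ∈ C)
    (hPproj : ∀ x, ∀ y ∈ C, ‖x - P x‖ ≤ ‖x - y‖) (x : E) {y : E} (hy : y ∈ C) :
    ⟪x - P x, y - P x⟫_ℝ ≤ 0 := by
  refine (norm_eq_iInf_iff_real_inner_le_zero hC (hPmem x)).1 (le_antisymm ?_ ?_) y hy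
  · have : Nonempty C := ⟨⟨P x, hPmem x⟩⟩
    exact le_ciInf fun w => hPproj x w w.2
  · exact ciInf_le (f := fun w : C => ‖x - w‖)
      ⟨0, by rintro _ ⟨w, rfl⟩; exact norm_nonneg _⟩ ⟨P x, hPmem x⟩

/-- The residual `x ↦ x - P x` of the metric projection onto a convex set is firmly nonexpansive. -/
lemma norm_sq_residual_sub_le (hC : Convex ℝ C) (hPmem : ∀ x, P x ∈ C)
    (hPproj : ∀ x, ∀ y ∈ C, ‖x - P x‖ ≤ ‖x - y‖) (x y : E) :
    ‖(x - P x) - (y - P y)‖ ^ 2 ≤ ⟪(x - P x) - (y - P y), x - y⟫_ℝ := by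
  have h₁ := inner_sub_proj_nonpos hC hPmem hPproj x (hPmem y)
  have h₂ := inner_sub_proj_nonpos hC hPmem hPproj y (hPmem x)
  have h₃ : ⟪(x - P x) - (y - P y), x - y⟫_ℝ = ‖(x - P x) - (y - P y)‖ ^ 2
      - ⟪x - P x, P y - P x⟫_ℝ - ⟪y - P y, P x - P y⟫_ℝ := by
    have h₄ : x - y = ((x - P x) - (y - P y)) - (P y - P x) := by abel
    rw [← neg_sub (P y) (P x), inner_neg_right, ← real_inner_self_eq_norm_sq]
    conv_lhs => rw [h₄]
    rw [inner_sub_right _ _ (P y - P x), inner_sub_left _ _ (P y - P x)]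
    ring
  linarith

lemma norm_residual_sub_le (hC : Convex ℝ C) (hPmem : ∀ x, P x ∈ C)
    (hPproj : ∀ x, ∀ y ∈ C, ‖x - P x‖ ≤ ‖x - y‖) (x y : E) :
    ‖(x - P x) - (y - P y)‖ ≤ ‖x - y‖ := by
  have h₁ := norm_sq_residual_sub_le hC hPmem hPproj x y
  have h₂ := real_inner_le_norm ((x - P x) - (y - P y)) (x - y)
  by_contra! hlt
  nlinarith [norm_nonneg (x - y)]

/-- The squared distance to a convex set has gradient `2 • (x - P x)`. -/
lemma hasGradientAt_norm_sq_residual [CompleteSpace E] (hC : Convex ℝ C) (hPmem : ∀ x, P x ∈ C)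
    (hPproj : ∀ x, ∀ y ∈ C, ‖x - P x‖ ≤ ‖x - y‖) (x : E) :
    HasGradientAt (fun y => ‖P y - y‖ ^ 2) ((2 : ℝ) • (x - P x)) x := by
  rw [hasGradientAt_iff_isLittleO]
  have hbound : ∀ y, ‖‖P y - y‖ ^ 2 - ‖P x - x‖ ^ 2 - ⟪(2 : ℝ) • (x - P x), y - x⟫_ℝ‖
      ≤ 1 * ‖‖y - x‖ ^ 2‖ := by
    intro y
    have key : ∀ u v : E, ‖P u - u‖ ^ 2
        ≤ ‖P v - v‖ ^ 2 + 2 * ⟪v - P v, u - v⟫_ℝ + ‖u - v‖ ^ 2 := by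
      intro u v
      rw [norm_sub_rev (P u), norm_sub_rev (P v), ← norm_add_sq_real, sub_add_sub_comm, add_comm v,
        add_sub_add_comm, add_comm (u - P v), ← add_sub_assoc, sub_self, zero_add]
      exact pow_le_pow_left₀ (norm_nonneg _) (hPproj u _ (hPmem v)) 2
    have hupper := key y x
    have hlower := key x y
    have hmono := (sq_nonneg _).trans (norm_sq_residual_sub_le hC hPmem hPproj y x)
    rw [inner_sub_left] at hmono
    rw [norm_sub_rev x y, ← neg_sub y x, inner_neg_right] at hlower
    rw [real_inner_smul_left, Real.norm_eq_abs, Real.norm_of_nonneg (sq_nonneg _), one_mul, abs_le]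
    constructor <;> linarith
  exact (Asymptotics.IsBigO.of_bound 1 (Filter.Eventually.of_forall hbound)).trans_isLittleO
    (Asymptotics.isLittleO_pow_sub_sub x one_lt_two)

end MetricProjection

/-- Chain rule for the gradient under precomposition with a continuous affine map. -/
lemma HasGradientAt.comp_clm_add_const {E F : Type*} [NormedAddCommGroup E]
    [InnerProductSpace ℝ E] [CompleteSpace E] [NormedAddCommGroup F] [InnerProductSpace ℝ F]
    [CompleteSpace F] {g : F → ℝ} {g' : F} (H : E →L[ℝ] F) (h : F) {z : E}
    (hg : HasGradientAt g g' (H z + h)) :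
    HasGradientAt (fun z => g (H z + h)) (ContinuousLinearMap.adjoint H g') z := by
  rw [hasGradientAt_iff_hasFDerivAt] at hg ⊢
  refine (hg.comp z (H.hasFDerivAt.add_const h)).congr_fderiv ?_
  ext v
  simp [ContinuousLinearMap.adjoint_inner_left]


/-- the substituted training loss
`L(z) = f̄(Hz + h) + (1/(2μ)) ‖P(Hz+h) − (Hz+h)‖²` is differentiable with Lipschitz
gradient of constant `‖H‖² (α + 2/μ)`, i.e. smooth. -/
theorem stmt_9 {E : Type*} [NormedAddCommGroup E] [InnerProductSpace ℝ E] [CompleteSpace E]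
    (C : Set E) (hCne : C.Nonempty) (hCcl : IsClosed C) (hCconv : Convex ℝ C)
    (P : E → E) (hPmem : ∀ x, P x ∈ C) (hPproj : ∀ x, ∀ y ∈ C, ‖x - P x‖ ≤ ‖x - y‖)
    (μ : ℝ) (hμ : 0 < μ) (H : E →L[ℝ] E) (h : E)
    (α : ℝ) (hα : 0 ≤ α)
    (fbar : E → ℝ) (hf : Differentiable ℝ fbar)
    (hgrad : ∀ x y, ‖gradient fbar x - gradient fbar y‖ ≤ α * ‖x - y‖)
    (L : E → ℝ)
    (hLdef : ∀ z, L z = fbar (H z + h) + (1 / (2 * μ)) * ‖P (H z + h) - (H z + h)‖ ^ 2) :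
    Differentiable ℝ L ∧
      ∀ z w, ‖gradient L z - gradient L w‖ ≤ ‖H‖ ^ 2 * (α + 2 / μ) * ‖z - w‖ := by
  have hL : ∀ z, HasGradientAt L (ContinuousLinearMap.adjoint H
      (gradient fbar (H z + h) + (1 / μ) • ((H z + h) - P (H z + h)))) z := by
    intro z
    rw [funext hLdef]
    refine HasGradientAt.comp_clm_add_const
      (g := fun x => fbar x + (1 / (2 * μ)) * ‖P x - x‖ ^ 2) H h ?_
    have hd := hasGradientAt_norm_sq_residual hCconv hPmem hPproj (H z + h)
    have hfz := (hf (H z + h)).hasGradientAt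
    rw [hasGradientAt_iff_hasFDerivAt] at hd hfz ⊢
    refine (hfz.add (hd.const_mul (1 / (2 * μ)))).congr_fderiv ?_
    have hc : 1 / (2 * μ) * 2 = 1 / μ := by field_simp
    ext v
    simp only [← hc, map_add, map_smul, mul_smul, add_apply, smul_apply,
      InnerProductSpace.toDual_apply_apply, smul_eq_mul]
  refine ⟨fun z => (hL z).differentiableAt, fun z w => ?_⟩
  rw [(hL z).gradient, (hL w).gradient, ← map_sub]
  set x := H z + h with hx
  set y := H w + h with hy
  have hxy : ‖x - y‖ ≤ ‖H‖ * ‖z - w‖ := by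
    rw [hx, hy, add_sub_add_right_eq_sub, ← map_sub]
    exact H.le_opNorm _
  have hres := norm_residual_sub_le hCconv hPmem hPproj x y
  have hμ' : 0 ≤ 1 / μ := by positivity
  have hinner : ‖(gradient fbar x + (1 / μ) • (x - P x))
      - (gradient fbar y + (1 / μ) • (y - P y))‖ ≤ (α + 2 / μ) * ‖x - y‖ := by
    rw [add_sub_add_comm, ← smul_sub]
    calc _ ≤ α * ‖x - y‖ + 1 / μ * ‖x - y‖ := by
          refine (norm_add_le _ _).trans (add_le_add (hgrad x y) ?_)
          rw [norm_smul, Real.norm_of_nonneg hμ']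
          gcongr
      _ ≤ (α + 2 / μ) * ‖x - y‖ := by
          rw [← add_mul]
          gcongr
          norm_num
  calc _ ≤ ‖H‖ * ((α + 2 / μ) * ‖x - y‖) := by
        refine (ContinuousLinearMap.le_opNorm _ _).trans ?_
        rw [LinearIsometryEquiv.norm_map]
        gcongr
    _ ≤ ‖H‖ * ((α + 2 / μ) * (‖H‖ * ‖z - w‖)) := by gcongr
    _ = ‖H‖ ^ 2 * (α + 2 / μ) * ‖z - w‖ := by ring
end

section
/- Let E be a real Hilbert space, let C be a nonempty closed convex subset of E with metric projection P : E → E (so P x ∈ C and ‖x − P x‖ ≤ ‖x − y‖ for all y ∈ C), let μ > 0, α ≥ 0, B ≥ 0, κ ∈ (0,1) and k ∈ ℕ. Let f̄ : E → ℝ be differentiable with α-Lipschitz gradient, let T : E → E be κ-Lipschitz with T z★ = z★, let Q : E → E be nonexpansive (1-Lipschitz) with Q z★ = x★ where x★ ∈ C, and set S = Q ∘ T^[k]. Define L(x) = f̄(x) + (1/(2μ)) ‖P x − x‖². Then for all z, w ∈ E with ‖z − z★‖ ≤ B and ‖w − z★‖ ≤ B, one has |L(S z) − L(S w)| ≤ κ^k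 ((α + 1/μ) κ^k B + ‖∇f̄(x★)‖) ‖z − w‖. -/
open scoped NNReal

section GradientBounds

variable {E : Type*} [NormedAddCommGroup E] [InnerProductSpace ℝ E] [CompleteSpace E]

/-- The gradient of a function has the same norm as its derivative. -/
theorem norm_gradient_eq_norm_fderiv (f : E → ℝ) (x : E) :
    ‖gradient f x‖ = ‖fderiv ℝ f x‖ :=
  (InnerProductSpace.toDual ℝ E).symm.norm_map _

/-- A function with `α`-Lipschitz gradient is Lipschitz on the ball of radius `R` around `c`, with
constant `α R + ‖∇f(c)‖`. -/
theorem abs_sub_le_of_lipschitzWith_gradient {f : E → ℝ} {α : ℝ≥0} (hf : Differentiable ℝ f)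
    (hgrad : LipschitzWith α (gradient f)) {c x y : E} {R : ℝ}
    (hx : ‖x - c‖ ≤ R) (hy : ‖y - c‖ ≤ R) :
    |f x - f y| ≤ (α * R + ‖gradient f c‖) * ‖x - y‖ := by
  rw [← mem_closedBall_iff_norm] at hx hy
  refine (convex_closedBall c R).norm_image_sub_le_of_norm_fderiv_le (𝕜 := ℝ)
    (fun u _ => hf u) (fun u hu => ?_) hy hx
  rw [← norm_gradient_eq_norm_fderiv]
  have hlip : ‖gradient f u - gradient f c‖ ≤ α * R :=
    (hgrad.norm_sub_le u c).trans
      (mul_le_mul_of_nonneg_left (mem_closedBall_iff_norm.1 hu) α.coe_nonneg)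
  linarith [norm_le_norm_sub_add (gradient f u) (gradient f c)]

end GradientBounds

/-- The squared distance to a set, measured through a nearest-point map `P`, is Lipschitz with
constant `2 R` on the ball of radius `R` around a point of the set. -/
theorem abs_sq_norm_sub_nearest_le {E : Type*} [SeminormedAddCommGroup E] {C : Set E} {P : E → E}
    (hPmem : ∀ x, P x ∈ C) (hPproj : ∀ x, ∀ y ∈ C, ‖x - P x‖ ≤ ‖x - y‖) {c x y : E} {R : ℝ}
    (hc : c ∈ C) (hx : ‖x - c‖ ≤ R) (hy : ‖y - c‖ ≤ R) :
    |‖P x - x‖ ^ 2 - ‖P y - y‖ ^ 2| ≤ 2 * R * ‖x - y‖ := by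
  have hdist : ∀ u v, ‖P u - u‖ - ‖P v - v‖ ≤ ‖u - v‖ := fun u v => by
    rw [norm_sub_rev (P u), norm_sub_rev (P v)]
    linarith [hPproj u (P v) (hPmem v), norm_sub_le_norm_sub_add_norm_sub u v (P v)]
  have hxR : ‖P x - x‖ ≤ R := norm_sub_rev (P x) x ▸ (hPproj x c hc).trans hx
  have hyR : ‖P y - y‖ ≤ R := norm_sub_rev (P y) y ▸ (hPproj y c hc).trans hy
  rw [sq_sub_sq, abs_mul, abs_of_nonneg (by positivity)]
  gcongr
  · linarith [norm_nonneg (P x - x)]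
  · linarith
  · exact abs_sub_le_iff.2 ⟨hdist x y, norm_sub_rev y x ▸ hdist y x⟩

/-- appendix, split constraints: the penalized loss
`L(x) = f̄(x) + (1/(2μ)) ‖P x − x‖²` evaluated at the k-th algorithm iterate is Lipschitz
in the initial point with constant `κ^k ((α + 1/μ) κ^k B + ‖∇f̄(x★)‖)`. -/
theorem stmt_12 {E : Type*} [NormedAddCommGroup E] [InnerProductSpace ℝ E] [CompleteSpace E]
    (C : Set E) (hCne : C.Nonempty) (hCcl : IsClosed C) (hCconv : Convex ℝ C)
    (P : E → E) (hPmem : ∀ x, P x ∈ C) (hPproj : ∀ x, ∀ y ∈ C, ‖x - P x‖ ≤ ‖x - y‖)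
    (μ : ℝ) (hμ : 0 < μ) (α : ℝ≥0) (B : ℝ) (hB : 0 ≤ B)
    (κ : ℝ≥0) (hκ0 : 0 < κ) (hκ1 : κ < 1) (k : ℕ)
    (fbar : E → ℝ) (hf : Differentiable ℝ fbar) (hgrad : LipschitzWith α (gradient fbar))
    (T Q : E → E) (z₀ x₀ : E)
    (hT : LipschitzWith κ T) (hTfix : T z₀ = z₀)
    (hQ : LipschitzWith 1 Q) (hQz : Q z₀ = x₀) (hx₀ : x₀ ∈ C)
    (L : E → ℝ) (hLdef : ∀ x, L x = fbar x + (1 / (2 * μ)) * ‖P x - x‖ ^ 2)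
    (z w : E) (hz : ‖z - z₀‖ ≤ B) (hw : ‖w - z₀‖ ≤ B) :
    |L (Q (T^[k] z)) - L (Q (T^[k] w))| ≤
      (κ : ℝ) ^ k * (((α : ℝ) + 1 / μ) * (κ : ℝ) ^ k * B + ‖gradient fbar x₀‖) *
        ‖z - w‖ := by
  have hS : LipschitzWith (κ ^ k) (Q ∘ T^[k]) := by simpa using hQ.comp (hT.iterate k)
  have hSfix : (Q ∘ T^[k]) z₀ = x₀ := by
    rw [Function.comp_apply, Function.iterate_fixed hTfix, hQz]
  have hball : ∀ u, ‖u - z₀‖ ≤ B → ‖Q (T^[k] u) - x₀‖ ≤ (κ : ℝ) ^ k * B := fun u hu => by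
    have h := hS.norm_sub_le u z₀
    rw [hSfix, NNReal.coe_pow] at h
    exact h.trans (by gcongr)
  have hSzw : ‖Q (T^[k] z) - Q (T^[k] w)‖ ≤ (κ : ℝ) ^ k * ‖z - w‖ := by
    simpa using hS.norm_sub_le z w
  have hloss := abs_sub_le_of_lipschitzWith_gradient hf hgrad (hball z hz) (hball w hw)
  have hpen := abs_sq_norm_sub_nearest_le hPmem hPproj hx₀ (hball z hz) (hball w hw)
  rw [hLdef, hLdef]
  generalize Q (T^[k] z) = x at *
  generalize Q (T^[k] w) = y at *
  calc |fbar x + 1 / (2 * μ) * ‖P x - x‖ ^ 2 - (fbar y + 1 / (2 * μ) * ‖P y - y‖ ^ 2)|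
      = |(fbar x - fbar y) + 1 / (2 * μ) * (‖P x - x‖ ^ 2 - ‖P y - y‖ ^ 2)| := by ring_nf
    _ ≤ |fbar x - fbar y| + 1 / (2 * μ) * |‖P x - x‖ ^ 2 - ‖P y - y‖ ^ 2| := by
        refine (abs_add_le _ _).trans_eq ?_
        rw [abs_mul, abs_of_pos (show 0 < 1 / (2 * μ) by positivity)]
    _ ≤ (α * ((κ : ℝ) ^ k * B) + ‖gradient fbar x₀‖) * ‖x - y‖
          + 1 / (2 * μ) * (2 * ((κ : ℝ) ^ k * B) * ‖x - y‖) := by gcongr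
    _ = ((α + 1 / μ) * (κ : ℝ) ^ k * B + ‖gradient fbar x₀‖) * ‖x - y‖ := by
        field_simp
        ring
    _ ≤ ((α + 1 / μ) * (κ : ℝ) ^ k * B + ‖gradient fbar x₀‖) * ((κ : ℝ) ^ k * ‖z - w‖) := by
        gcongr
    _ = _ := by ring
end
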